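/- Let k ≥ 4 and let w = ξ^ℓ(0) with 0 ≤ ℓ ≤ 2k−2, ℓ ≠ k−1. Suppose x, y ∈ Rext(w) are distinct letters with π(x) = π(y), and u, v ∈ A* are words with |u| = |v| such that wxu and wyv are factors of u_k and π(wxu) = π(wyv). Then |u| = |v| ≤ 1 if 0 ≤ ℓ ≤ k−2, and |u| = |v| = 0 if k ≤ ℓ ≤ 2k−2. -/

import Mathlib

open List Filter Topology

/-- The alphabet `A`: the letter `(b, j)` is the unprimed letter `j` if `b = false`
and the primed letter `j′` if `b = true`.  Only letters with `j < k` occur. -/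
abbrev Letter : Type := Bool × ℕ

/-- The morphism ξ_k on letters: `0 ↦ 01`, `j ↦ j+1` for `1 ≤ j ≤ k−2`, `k−1 ↦ 0′`,
and symmetrically on primed letters with `(k−1)′ ↦ 0`. -/
def xiL (k : ℕ) (a : Letter) : List Letter :=
  if a.2 = 0 then [(a.1, 0), (a.1, 1)]
  else if a.2 = k - 1 then [(!a.1, 0)]
  else [(a.1, a.2 + 1)]

/-- The morphism ξ_k on finite words. -/
def xiW (k : ℕ) (w : List Letter) : List Letter := w.flatMap (xiL k)

/-- The word ξ_k^n(0). -/
def xiPow (k n : ℕ) : List Letter := (xiW k)^[n] [((false : Bool), (0 : ℕ))]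

/-- The projection π : A → {0,1}, with `false` playing the role of `0` and
`true` the role of `1`. -/
def proj (a : Letter) : Bool := if a.2 = 0 then a.1 else !a.1

/-- The twin map `ℓ ↔ ℓ′` on letters. -/
def twin (a : Letter) : Letter := (!a.1, a.2)

/-- The finite word `w` occurs in the infinite word `v` at position `j`. -/
def OccursAt {α : Type*} (w : List α) (v : ℕ → α) (j : ℕ) : Prop :=
  ∀ i, i < w.length → w[i]? = some (v (j + i))

/-- The finite word `w` is a prefix of the infinite word `v`. -/
def PrefixSeq {α : Type*} (w : List α) (v : ℕ → α) : Prop := OccursAt w v 0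

/-- The finite word `w` is a factor of the infinite word `v`. -/
def FactorOf {α : Type*} (w : List α) (v : ℕ → α) : Prop := ∃ j, OccursAt w v j

/-- `v` is the fixed point `u_k = ξ_k^ω(0)`: every `ξ_k^n(0)` is a prefix of `v`. -/
def IsFixedPoint (k : ℕ) (v : ℕ → Letter) : Prop := ∀ n, PrefixSeq (xiPow k n) v

/-- `q ≥ 1` is a period of the finite word `z`. -/
def HasPeriod {α : Type*} (z : List α) (q : ℕ) : Prop :=
  1 ≤ q ∧ ∀ i, i + q < z.length → z[i]? = z[i + q]?

/-- `w` is a left special factor of the infinite word `v`. -/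
def LeftSpecial {α : Type*} (w : List α) (v : ℕ → α) : Prop :=
  ∃ a b : α, a ≠ b ∧ FactorOf (a :: w) v ∧ FactorOf (b :: w) v

/-- `w` is a right special factor of the infinite word `v`. -/
def RightSpecial {α : Type*} (w : List α) (v : ℕ → α) : Prop :=
  ∃ a b : α, a ≠ b ∧ FactorOf (w ++ [a]) v ∧ FactorOf (w ++ [b]) v

/-- `w` is a bispecial factor of the infinite word `v`. -/
def Bispecial {α : Type*} (w : List α) (v : ℕ → α) : Prop :=
  LeftSpecial w v ∧ RightSpecial w v

/-- The set of left extensions of `w` in `v`. -/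
def Lext {α : Type*} (w : List α) (v : ℕ → α) : Set α := {a | FactorOf (a :: w) v}

/-- The set of right extensions of `w` in `v`. -/
def Rext {α : Type*} (w : List α) (v : ℕ → α) : Set α := {a | FactorOf (w ++ [a]) v}

/-- `r` is a return word to `w` in `v`: it spans two consecutive occurrences of `w`. -/
def ReturnWordTo {α : Type*} (r w : List α) (v : ℕ → α) : Prop :=
  ∃ j ℓ, j < ℓ ∧ OccursAt w v j ∧ OccursAt w v ℓ ∧
    (∀ m, j < m → m < ℓ → ¬ OccursAt w v m) ∧
    r = (List.range (ℓ - j)).map (fun i => v (j + i))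

/-- The factor complexity of an infinite word. -/
noncomputable def complexity {α : Type*} (v : ℕ → α) (n : ℕ) : ℕ :=
  {w : List α | w.length = n ∧ FactorOf w v}.ncard

theorem occursAt_append {α : Type*} {p r : List α} {v : ℕ → α} {j : ℕ} :
    OccursAt (p ++ r) v j ↔ OccursAt p v j ∧ OccursAt r v (j + p.length) := by
  constructor
  · intro h
    refine ⟨fun i hi => ?_, fun i hi => ?_⟩
    · have := h i (by simp; omega)
      rwa [List.getElem?_append_left hi] at this
    · have := h (p.length + i) (by simp; omega)
      rw [List.getElem?_append_right (by omega)] at this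
      simpa [Nat.add_assoc] using this
  · rintro ⟨h1, h2⟩ i hi
    by_cases hip : i < p.length
    · rw [List.getElem?_append_left hip]
      exact h1 i hip
    · rw [List.getElem?_append_right (by omega), h2 _ (by simp at hi; omega)]
      congr 2
      omega

theorem occursAt_nil {α : Type*} (v : ℕ → α) (j : ℕ) : OccursAt [] v j := by
  intro i hi
  simp at hi

theorem occursAt_singleton {α : Type*} {a : α} {v : ℕ → α} {j : ℕ} :
    OccursAt [a] v j ↔ v j = a := by
  constructor
  · intro h
    simpa [eq_comm] using h 0 (by simp)
  · rintro rfl i hi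
    obtain rfl : i = 0 := by simpa using hi
    simp

theorem occursAt_cons {α : Type*} {a : α} {r : List α} {v : ℕ → α} {j : ℕ} :
    OccursAt (a :: r) v j ↔ v j = a ∧ OccursAt r v (j + 1) := by
  rw [← List.singleton_append, occursAt_append, occursAt_singleton]
  simp

theorem occursAt_map_range {α : Type*} (v : ℕ → α) (n : ℕ) :
    OccursAt ((List.range n).map v) v 0 := by
  intro i hi
  have : i < n := by simpa using hi
  simp [this]

theorem OccursAt.eq_of_length_eq {α : Type*} {p r : List α} {v : ℕ → α} {j : ℕ}
    (hp : OccursAt p v j) (hr : OccursAt r v j) (h : p.length = r.length) : p = r := by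
  apply List.ext_getElem? fun i => ?_
  by_cases hi : i < p.length
  · rw [hp i hi, hr i (h ▸ hi)]
  · rw [List.getElem?_eq_none (by omega), List.getElem?_eq_none (by omega)]

theorem xiW_append (k : ℕ) (p r : List Letter) : xiW k (p ++ r) = xiW k p ++ xiW k r := by
  simp [xiW]

theorem xiW_cons (k : ℕ) (a : Letter) (r : List Letter) :
    xiW k (a :: r) = xiL k a ++ xiW k r := by
  simp [xiW]

theorem xiW_singleton (k : ℕ) (a : Letter) : xiW k [a] = xiL k a := by
  simp [xiW]

theorem xiL_zero (k : ℕ) (b : Bool) : xiL k (b, 0) = [(b, 0), (b, 1)] := by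
  simp [xiL]

theorem xiL_last {k : ℕ} (hk : 4 ≤ k) (b : Bool) : xiL k (b, k - 1) = [(!b, 0)] := by
  simp [xiL, show k - 1 ≠ 0 by omega]

theorem xiL_mid {k j : ℕ} (b : Bool) (h0 : j ≠ 0) (h : j ≠ k - 1) :
    xiL k (b, j) = [(b, j + 1)] := by
  simp [xiL, h0, h]

theorem xiW_iterate_append (k j : ℕ) (p r : List Letter) :
    (xiW k)^[j] (p ++ r) = (xiW k)^[j] p ++ (xiW k)^[j] r := by
  induction j generalizing p r with
  | zero => rfl
  | succ j ih => simp only [Function.iterate_succ_apply, xiW_append, ih]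

theorem xiW_iterate_mid {k : ℕ} (b : Bool) {a j : ℕ} (ha : 1 ≤ a) (h : a + j ≤ k - 1) :
    (xiW k)^[j] [(b, a)] = [(b, a + j)] := by
  induction j with
  | zero => rfl
  | succ j ih =>
    rw [Function.iterate_succ_apply', ih (by omega), xiW_singleton,
      xiL_mid b (by omega) (by omega), Nat.add_assoc]

theorem xiW_iterate_wrap {k : ℕ} (hk : 4 ≤ k) (b : Bool) {a j : ℕ} (ha : 1 ≤ a)
    (h : a + j = k) (hak : a ≤ k - 1) : (xiW k)^[j] [(b, a)] = [(!b, 0)] := by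
  obtain ⟨j, rfl⟩ : ∃ i, j = i + 1 := ⟨j - 1, by omega⟩
  rw [Function.iterate_succ_apply', xiW_iterate_mid b ha (by omega), xiW_singleton,
    show a + j = k - 1 by omega, xiL_last hk]

theorem xiW_iterate_succ_zero (k j : ℕ) (b : Bool) :
    (xiW k)^[j + 1] [(b, 0)] = (xiW k)^[j] [(b, 0)] ++ (xiW k)^[j] [(b, 1)] := by
  rw [Function.iterate_succ_apply, xiW_singleton, xiL_zero, ← xiW_iterate_append]
  rfl

theorem xiW_iterate_zero_head (k j : ℕ) (b : Bool) :
    ∃ r, (xiW k)^[j] [(b, 0)] = (b, 0) :: r := by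
  induction j with
  | zero => exact ⟨[], rfl⟩
  | succ j ih =>
    obtain ⟨r, hr⟩ := ih
    exact ⟨r ++ (xiW k)^[j] [(b, 1)], by rw [xiW_iterate_succ_zero, hr]; rfl⟩

theorem xiW_iterate_zero_head_two (k : ℕ) {j : ℕ} (hj : 1 ≤ j) (b : Bool) :
    ∃ r, (xiW k)^[j] [(b, 0)] = (b, 0) :: (b, 1) :: r := by
  induction j, hj using Nat.le_induction with
  | base => exact ⟨[], by simp [xiW, xiL]⟩
  | succ j _ ih =>
    obtain ⟨r, hr⟩ := ih
    exact ⟨r ++ (xiW k)^[j] [(b, 1)], by rw [xiW_iterate_succ_zero, hr]; rfl⟩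

theorem xiW_iterate_zero_head_three {k : ℕ} (hk : 4 ≤ k) {j : ℕ} (hj : 2 ≤ j) (b : Bool) :
    ∃ r, (xiW k)^[j] [(b, 0)] = (b, 0) :: (b, 1) :: (b, 2) :: r := by
  induction j, hj using Nat.le_induction with
  | base =>
    refine ⟨[], ?_⟩
    rw [xiW_iterate_succ_zero, xiW_iterate_succ_zero, xiW_iterate_mid b le_rfl (by omega),
      xiW_iterate_mid b le_rfl (by omega)]
    rfl
  | succ j _ ih =>
    obtain ⟨r, hr⟩ := ih
    exact ⟨r ++ (xiW k)^[j] [(b, 1)], by rw [xiW_iterate_succ_zero, hr]; rfl⟩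

theorem xiW_iterate_zero_last {k : ℕ} (b : Bool) {j : ℕ} (hj : j ≤ k - 1) :
    ∃ p, (xiW k)^[j] [(b, 0)] = p ++ [(b, j)] := by
  cases j with
  | zero => exact ⟨[], rfl⟩
  | succ j =>
    refine ⟨(xiW k)^[j] [(b, 0)], ?_⟩
    rw [xiW_iterate_succ_zero, xiW_iterate_mid b le_rfl (by omega), Nat.add_comm 1 j]

theorem xiPow_succ (k j : ℕ) : xiPow k (j + 1) = xiW k (xiPow k j) :=
  Function.iterate_succ_apply' _ _ _

theorem xiPow_add {k : ℕ} (hk : 4 ≤ k) (m : ℕ) :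
    xiPow k (k + m) = xiPow k (k - 1 + m) ++ (xiW k)^[m] [(true, 0)] := by
  have h := xiW_iterate_succ_zero k (k - 1 + m) false
  rw [show k - 1 + m + 1 = k + m by omega] at h
  rw [xiPow, h, Nat.add_comm (k - 1) m,
    Function.iterate_add_apply _ m (k - 1) [((false : Bool), 1)],
    xiW_iterate_wrap hk false le_rfl (by omega) (by omega)]
  rfl

theorem xiPow_last {k : ℕ} (hk : 4 ≤ k) {j : ℕ} (hj : j ≤ 2 * k - 3) (hj' : j ≠ k - 1) :
    ∃ p a, xiPow k j = p ++ [a] ∧ a.2 ≠ k - 1 := by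
  rcases Nat.lt_or_ge j k with h | h
  · obtain ⟨p, hp⟩ := xiW_iterate_zero_last (k := k) false (show j ≤ k - 1 by omega)
    exact ⟨p, _, hp, hj'⟩
  · obtain ⟨m, rfl⟩ := Nat.exists_eq_add_of_le h
    obtain ⟨p, hp⟩ := xiW_iterate_zero_last (k := k) true (show m ≤ k - 1 by omega)
    exact ⟨xiPow k (k - 1 + m) ++ p, (true, m), by rw [xiPow_add hk, hp, List.append_assoc],
      by simp; omega⟩

theorem xiL_length_pos (k : ℕ) (a : Letter) : 1 ≤ (xiL k a).length := by
  unfold xiL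
  split_ifs <;> simp

theorem length_le_xiW_length (k : ℕ) (w : List Letter) : w.length ≤ (xiW k w).length := by
  induction w with
  | nil => simp
  | cons a w ih =>
    have := xiL_length_pos k a
    rw [xiW_cons, List.length_append, List.length_cons]
    omega

theorem lt_xiPow_length (k n : ℕ) : n < (xiPow k n).length := by
  induction n with
  | zero => simp [xiPow]
  | succ n ih =>
    obtain ⟨r, hr⟩ := xiW_iterate_zero_head k n false
    have h : xiPow k n = (false, 0) :: r := hr
    have := length_le_xiW_length k r
    rw [h] at ih
    rw [xiPow_succ, h, xiW_cons, xiL_zero]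
    simp at ih ⊢
    omega

/-- The position in `ξ(v)` at which the image of the letter `v n` starts. -/
def imagePos (k : ℕ) (v : ℕ → Letter) (n : ℕ) : ℕ := (xiW k ((List.range n).map v)).length

theorem imagePos_succ (k : ℕ) (v : ℕ → Letter) (n : ℕ) :
    imagePos k v (n + 1) = imagePos k v n + (xiL k (v n)).length := by
  simp [imagePos, List.range_succ, xiW_append, xiW_singleton]

namespace IsFixedPoint

variable {k : ℕ} {u : ℕ → Letter}

theorem occursAt_xiW (hu : IsFixedPoint k u) {w : List Letter} {n : ℕ} (hw : OccursAt w u n) :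
    OccursAt (xiW k w) u (imagePos k u n) := by
  set p := (List.range n).map u with hp
  have hpw : OccursAt (p ++ w) u 0 := by
    rw [occursAt_append]
    exact ⟨occursAt_map_range u n, by simpa [hp] using hw⟩
  set N := n + w.length with hN
  have hlen := lt_xiPow_length k N
  have hpre : p ++ w = (xiPow k N).take N := by
    have h := hu N
    unfold PrefixSeq at h
    rw [← List.take_append_drop N (xiPow k N), occursAt_append] at h
    exact hpw.eq_of_length_eq h.1 (by simp [hp]; omega)
  have h := hu (N + 1)
  unfold PrefixSeq at h
  rw [xiPow_succ, ← List.take_append_drop N (xiPow k N), ← hpre, xiW_append, xiW_append,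
    List.append_assoc, occursAt_append, occursAt_append] at h
  simpa [imagePos] using h.2.1

theorem occursAt_iterate (hu : IsFixedPoint k u) {w : List Letter} {n : ℕ} (j : ℕ)
    (hw : OccursAt w u n) : OccursAt ((xiW k)^[j] w) u ((imagePos k u)^[j] n) := by
  induction j with
  | zero => exact hw
  | succ j ih =>
    rw [Function.iterate_succ_apply', Function.iterate_succ_apply']
    exact hu.occursAt_xiW ih

theorem occursAt_xiL (hu : IsFixedPoint k u) (n : ℕ) :
    OccursAt (xiL k (u n)) u (imagePos k u n) := by
  rw [← xiW_singleton]
  exact hu.occursAt_xiW (occursAt_singleton.2 rfl)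

theorem image_zero (hu : IsFixedPoint k u) {n : ℕ} {b : Bool} (h : u n = (b, 0)) :
    u (imagePos k u n) = (b, 0) ∧ u (imagePos k u n + 1) = (b, 1) ∧
      imagePos k u (n + 1) = imagePos k u n + 2 := by
  have h1 := hu.occursAt_xiL n
  have h2 := imagePos_succ k u n
  rw [h, xiL_zero] at h1 h2
  simp only [occursAt_cons] at h1
  exact ⟨h1.1, h1.2.1, h2⟩

theorem image_last (hk : 4 ≤ k) (hu : IsFixedPoint k u) {n : ℕ} {b : Bool}
    (h : u n = (b, k - 1)) :
    u (imagePos k u n) = (!b, 0) ∧ imagePos k u (n + 1) = imagePos k u n + 1 := by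
  have h1 := hu.occursAt_xiL n
  have h2 := imagePos_succ k u n
  rw [h, xiL_last hk] at h1 h2
  exact ⟨occursAt_singleton.1 h1, h2⟩

theorem image_mid (hu : IsFixedPoint k u) {n : ℕ} {b : Bool} {j : ℕ} (h : u n = (b, j))
    (h0 : j ≠ 0) (hl : j ≠ k - 1) :
    u (imagePos k u n) = (b, j + 1) ∧ imagePos k u (n + 1) = imagePos k u n + 1 := by
  have h1 := hu.occursAt_xiL n
  have h2 := imagePos_succ k u n
  rw [h, xiL_mid b h0 hl] at h1 h2
  exact ⟨occursAt_singleton.1 h1, h2⟩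

theorem image_ne_one (hk : 4 ≤ k) (hu : IsFixedPoint k u) (n : ℕ) :
    (u (imagePos k u n)).2 ≠ 1 := by
  rcases hn : u n with ⟨b, j⟩
  by_cases h0 : j = 0
  · subst h0
    simp [(hu.image_zero hn).1]
  by_cases hl : j = k - 1
  · subst hl
    simp [(hu.image_last hk hn).1]
  · simp [(hu.image_mid hn h0 hl).1, h0]

theorem exists_imagePos (hk : 4 ≤ k) (hu : IsFixedPoint k u) (i : ℕ) :
    ∃ n, i = imagePos k u n ∨ (i = imagePos k u n + 1 ∧ (u n).2 = 0) := by
  induction i with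
  | zero => exact ⟨0, Or.inl rfl⟩
  | succ i ih =>
    obtain ⟨n, rfl | ⟨rfl, hn⟩⟩ := ih
    · rcases hn : u n with ⟨b, j⟩
      by_cases h0 : j = 0
      · exact ⟨n, Or.inr ⟨rfl, by simp [hn, h0]⟩⟩
      refine ⟨n + 1, Or.inl ?_⟩
      by_cases hl : j = k - 1
      · subst hl
        exact (hu.image_last hk hn).2.symm
      · exact (hu.image_mid hn h0 hl).2.symm
    · rcases h : u n with ⟨b, j⟩
      obtain rfl : j = 0 := by simpa [h] using hn
      exact ⟨n + 1, Or.inl (hu.image_zero h).2.2.symm⟩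

theorem exists_imagePos_of_ne_one (hk : 4 ≤ k) (hu : IsFixedPoint k u) {i : ℕ}
    (hi : (u i).2 ≠ 1) : ∃ n, i = imagePos k u n := by
  obtain ⟨n, h | ⟨rfl, hn⟩⟩ := hu.exists_imagePos hk i
  · exact ⟨n, h⟩
  · rcases h : u n with ⟨b, j⟩
    obtain rfl : j = 0 := by simpa [h] using hn
    exact absurd (by rw [(hu.image_zero h).2.1]) hi

theorem preimage_zero_one (hk : 4 ≤ k) (hu : IsFixedPoint k u) {n : ℕ} {b : Bool}
    (h : u (imagePos k u n) = (b, 0)) (h' : (u (imagePos k u n + 1)).2 = 1) : u n = (b, 0) := by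
  rcases hn : u n with ⟨c, j⟩
  by_cases h0 : j = 0
  · subst h0
    rw [← h, (hu.image_zero hn).1]
  by_cases hl : j = k - 1
  · subst hl
    have := hu.image_ne_one hk (n + 1)
    rw [(hu.image_last hk hn).2] at this
    exact absurd h' this
  · rw [(hu.image_mid hn h0 hl).1] at h
    simp at h

theorem preimage_zero (hk : 4 ≤ k) (hu : IsFixedPoint k u) {n : ℕ} {b : Bool}
    (h : u (imagePos k u n) = (b, 0)) (h' : (u (imagePos k u n + 1)).2 ≠ 1) :
    u n = (!b, k - 1) := by
  rcases hn : u n with ⟨c, j⟩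
  by_cases h0 : j = 0
  · subst h0
    exact absurd (by rw [(hu.image_zero hn).2.1]) h'
  by_cases hl : j = k - 1
  · subst hl
    rw [(hu.image_last hk hn).1] at h
    simp only [Prod.mk.injEq, and_true] at h
    simp [← h]
  · rw [(hu.image_mid hn h0 hl).1] at h
    simp at h

theorem preimage_succ (hk : 4 ≤ k) (hu : IsFixedPoint k u) {n : ℕ} {b : Bool} {j : ℕ}
    (h : u (imagePos k u n) = (b, j + 1)) : u n = (b, j) := by
  rcases hn : u n with ⟨c, i⟩
  by_cases h0 : i = 0
  · subst h0
    rw [(hu.image_zero hn).1] at h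
    simp at h
  by_cases hl : i = k - 1
  · subst hl
    rw [(hu.image_last hk hn).1] at h
    simp at h
  · rw [(hu.image_mid hn h0 hl).1] at h
    simpa using h

theorem eq_of_occursAt_xiL (hk : 4 ≤ k) (hu : IsFixedPoint k u) {n : ℕ} {a : Letter}
    (h : OccursAt (xiL k a) u (imagePos k u n))
    (h' : a.2 = k - 1 → (u (imagePos k u n + 1)).2 ≠ 1) : u n = a := by
  obtain ⟨b, j⟩ := a
  by_cases h0 : j = 0
  · subst h0
    rw [xiL_zero, occursAt_cons, occursAt_singleton] at h
    exact hu.preimage_zero_one hk h.1 (by rw [h.2])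
  by_cases hl : j = k - 1
  · subst hl
    rw [xiL_last hk, occursAt_singleton] at h
    simpa using hu.preimage_zero hk h (h' rfl)
  · rw [xiL_mid b h0 hl, occursAt_singleton] at h
    exact hu.preimage_succ hk h

theorem exists_xiL_head (hk : 4 ≤ k) (a : Letter) : ∃ c r, xiL k a = c :: r ∧ c.2 ≠ 1 := by
  obtain ⟨b, j⟩ := a
  by_cases h0 : j = 0
  · exact ⟨_, _, by rw [h0, xiL_zero], by simp⟩
  by_cases hl : j = k - 1
  · exact ⟨_, _, by rw [hl, xiL_last hk], by simp⟩
  · exact ⟨_, _, xiL_mid b h0 hl, by simpa⟩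

theorem occursAt_of_occursAt_xiW (hk : 4 ≤ k) (hu : IsFixedPoint k u) {w : List Letter}
    {a : Letter} (ha : a.2 ≠ k - 1) {n : ℕ}
    (h : OccursAt (xiW k (w ++ [a])) u (imagePos k u n)) : OccursAt (w ++ [a]) u n := by
  induction w generalizing n with
  | nil =>
    rw [List.nil_append, xiW_singleton] at h
    rw [List.nil_append, occursAt_singleton]
    exact hu.eq_of_occursAt_xiL hk h fun h' => absurd h' ha
  | cons b w ih =>
    rw [List.cons_append, xiW_cons, occursAt_append] at h
    have hb : u n = b := by
      refine hu.eq_of_occursAt_xiL hk h.1 fun hbk => ?_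
      have hb' : (xiL k b).length = 1 := by
        rw [show b = (b.1, k - 1) from Prod.ext rfl hbk, xiL_last hk]
        rfl
      obtain ⟨c, r, hc, hc1⟩ : ∃ c r, xiW k (w ++ [a]) = c :: r ∧ c.2 ≠ 1 := by
        cases w with
        | nil =>
          obtain ⟨c, r, hc, hc1⟩ := exists_xiL_head hk a
          exact ⟨c, r, by rw [List.nil_append, xiW_singleton, hc], hc1⟩
        | cons d w =>
          obtain ⟨c, r, hc, hc1⟩ := exists_xiL_head hk d
          exact ⟨c, r ++ xiW k (w ++ [a]), by rw [List.cons_append, xiW_cons, hc]; rfl, hc1⟩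
      rw [hc, hb', occursAt_cons] at h
      rw [h.2.1]
      exact hc1
    rw [List.cons_append, occursAt_cons]
    refine ⟨hb, ih ?_⟩
    rw [imagePos_succ, hb]
    exact h.2

theorem zero (hu : IsFixedPoint k u) : u 0 = (false, 0) :=
  occursAt_singleton.1 (hu 0)

theorem lt_imagePos (hu : IsFixedPoint k u) (n : ℕ) : n + 1 < imagePos k u (n + 1) := by
  induction n with
  | zero => rw [(hu.image_zero hu.zero).2.2]; omega
  | succ n ih =>
    have := xiL_length_pos k (u (n + 1))
    rw [imagePos_succ]
    omega

/-- A letter `j` is followed by `j + 1` (if that is a letter), `0` or `0′`. -/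
theorem next_letter (hk : 4 ≤ k) (hu : IsFixedPoint k u) (i : ℕ) :
    (u (i + 1) = ((u i).1, (u i).2 + 1) ∧ (u i).2 + 1 < k) ∨ (u (i + 1)).2 = 0 := by
  induction i using Nat.strong_induction_on with
  | _ i ih =>
    obtain ⟨n, h | ⟨h, hn⟩⟩ := hu.exists_imagePos hk (i + 1)
    · cases n with
      | zero => simp [imagePos, xiW] at h
      | succ n =>
        have hlt := hu.lt_imagePos n
        rcases hn : u n with ⟨b, j⟩
        rcases ih n (by omega) with ⟨h1, h2⟩ | h0
        · rw [hn] at h1 h2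
          simp only at h1 h2
          rw [h]
          by_cases hl : j + 1 = k - 1
          · rw [hl] at h1
            exact Or.inr (by rw [(hu.image_last hk h1).1])
          left
          rw [(hu.image_mid h1 (by omega) hl).1]
          by_cases h0 : j = 0
          · subst h0
            obtain ⟨_, h4, h5⟩ := hu.image_zero hn
            rw [show i = imagePos k u n + 1 by omega, h4]
            exact ⟨rfl, by simp; omega⟩
          · obtain ⟨h4, h5⟩ := hu.image_mid hn h0 (by omega)
            rw [show i = imagePos k u n by omega, h4]
            exact ⟨rfl, by simp; omega⟩
        · right
          rcases hc : u (n + 1) with ⟨c, l⟩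
          obtain rfl : l = 0 := by simpa [hc] using h0
          rw [h, (hu.image_zero hc).1]
    · rcases hb : u n with ⟨b, j⟩
      obtain rfl : j = 0 := by simpa [hb] using hn
      obtain ⟨h3, h4, -⟩ := hu.image_zero hb
      left
      rw [h, h4, show i = imagePos k u n by omega, h3]
      exact ⟨rfl, by simp; omega⟩

theorem next_cases (hk : 4 ≤ k) (hu : IsFixedPoint k u) {i : ℕ} {b : Bool} {j : ℕ}
    (h : u i = (b, j)) :
    (u (i + 1) = (b, j + 1) ∧ j + 1 < k) ∨ u (i + 1) = (b, 0) ∨ u (i + 1) = (!b, 0) := by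
  have := hu.next_letter hk i
  rw [h] at this
  rcases this with h1 | h1
  · exact Or.inl h1
  · right
    rcases hc : u (i + 1) with ⟨c, l⟩
    obtain rfl : l = 0 := by simpa [hc] using h1
    cases b <;> cases c <;> simp

/-- The factor `00′` is always followed by `1′`. -/
theorem next_of_zero_twin (hk : 4 ≤ k) (hu : IsFixedPoint k u) {i : ℕ} {b : Bool}
    (h : u i = (b, 0)) (h' : u (i + 1) = (!b, 0)) : u (i + 2) = (!b, 1) := by
  rcases hu.next_letter hk (i + 1) with h1 | h1
  · rw [h'] at h1
    exact h1.1
  · exfalso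
    obtain ⟨n, rfl⟩ := hu.exists_imagePos_of_ne_one hk (i := i) (by simp [h])
    have h2 := hu.preimage_zero hk h (by simp [h'])
    rw [← (hu.image_last hk h2).2] at h' h1
    have h3 := hu.preimage_zero hk h' (by simp [h1])
    rcases hu.next_cases hk h2 with ⟨_, h4⟩ | h4 | h4
    · omega
    all_goals
      rw [h3, Prod.mk.injEq] at h4
      omega

/-- The word `00′1′0′` is not a factor. -/
theorem next_of_zero_twin_one (hk : 4 ≤ k) (hu : IsFixedPoint k u) {i : ℕ} {b : Bool}
    (h : u i = (b, 0)) (h' : u (i + 1) = (!b, 0)) : u (i + 3) ≠ (!b, 0) := by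
  intro h3
  have h2 := hu.next_of_zero_twin hk h h'
  obtain ⟨n, rfl⟩ := hu.exists_imagePos_of_ne_one hk (i := i) (by simp [h])
  have g0 := hu.preimage_zero hk h (by simp [h'])
  have e0 := (hu.image_last hk g0).2
  have g1 : u (n + 1) = (!b, 0) := by
    apply hu.preimage_zero_one hk
    · rw [e0, h']
    · rw [e0, Nat.add_assoc, h2]
  have e1 := (hu.image_zero g1).2.2
  rw [e0] at e1
  have g2 : u (n + 2) = (!b, 0) := by
    rcases hu.next_cases hk g1 with ⟨h4, _⟩ | h4 | h4
    · have := (hu.image_mid h4 (by omega) (by omega)).1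
      rw [e1, h3] at this
      simp at this
    · exact h4
    · have := (hu.image_zero h4).1
      rw [e1, h3] at this
      simp at this
  obtain ⟨p, rfl⟩ := hu.exists_imagePos_of_ne_one hk (i := n) (by simp [g0]; omega)
  have f0 : u p = (!b, k - 2) :=
    hu.preimage_succ hk (by rw [g0, show k - 2 + 1 = k - 1 by omega])
  have e2 := (hu.image_mid f0 (by omega) (by omega)).2
  have f1 : u (p + 1) = (!!b, k - 1) := by
    apply hu.preimage_zero hk
    · rw [e2, g1]
    · rw [e2, Nat.add_assoc, g2]
      simp
  rcases hu.next_cases hk f0 with ⟨h4, _⟩ | h4 | h4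
  · rw [f1] at h4
    simp at h4
  all_goals
    rw [f1, Prod.mk.injEq] at h4
    omega

theorem exists_of_occursAt_xiPow_succ (hk : 4 ≤ k) (hu : IsFixedPoint k u) {j i : ℕ}
    (hj : j ≤ 2 * k - 3) (hj' : j ≠ k - 1) (h : OccursAt (xiPow k (j + 1)) u i) :
    ∃ n, i = imagePos k u n ∧ OccursAt (xiPow k j) u n := by
  obtain ⟨r, hr⟩ := xiW_iterate_zero_head k (j + 1) false
  have hi : u i = (false, 0) := by
    have h' := h
    rw [xiPow, hr, occursAt_cons] at h'
    exact h'.1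
  obtain ⟨n, rfl⟩ := hu.exists_imagePos_of_ne_one hk (i := i) (by simp [hi])
  obtain ⟨p, a, hp, ha⟩ := xiPow_last hk hj hj'
  rw [xiPow_succ, hp] at h
  exact ⟨n, rfl, hp ▸ hu.occursAt_of_occursAt_xiW hk ha h⟩

theorem exists_of_occursAt_xiPow_small (hk : 4 ≤ k) (hu : IsFixedPoint k u) {j i : ℕ}
    (hj : j ≤ k - 1) (h : OccursAt (xiPow k j) u i) :
    ∃ n, i = (imagePos k u)^[j] n ∧ u n = (false, 0) := by
  induction j generalizing i with
  | zero => exact ⟨i, rfl, occursAt_singleton.1 h⟩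
  | succ j ih =>
    obtain ⟨m, rfl, hm⟩ := hu.exists_of_occursAt_xiPow_succ hk (by omega) (by omega) h
    obtain ⟨n, rfl, hn⟩ := ih (by omega) hm
    exact ⟨n, (Function.iterate_succ_apply' _ _ _).symm, hn⟩

theorem exists_of_occursAt_xiPow_large (hk : 4 ≤ k) (hu : IsFixedPoint k u) {m i : ℕ}
    (hm : m ≤ k - 2) (h : OccursAt (xiPow k (k + m)) u i) :
    ∃ n, i = (imagePos k u)^[m + (k - 1)] n ∧ u n = (false, 0) := by
  induction m generalizing i with
  | zero =>
    rw [xiPow_add hk, occursAt_append] at h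
    simpa using hu.exists_of_occursAt_xiPow_small hk le_rfl h.1
  | succ m ih =>
    obtain ⟨p, rfl, hp⟩ :=
      hu.exists_of_occursAt_xiPow_succ hk (j := k + m) (by omega) (by omega) h
    obtain ⟨n, rfl, hn⟩ := ih (by omega) hp
    exact ⟨n, by rw [← Function.iterate_succ_apply' (imagePos k u)]; congr 2; omega, hn⟩

/-- The letters that can follow an occurrence of `ξ^ℓ(0)` with `ℓ ≤ k − 2`. -/
theorem after_xiPow_small (hk : 4 ≤ k) (hu : IsFixedPoint k u) {ℓ i P : ℕ} (hℓ : ℓ ≤ k - 2)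
    (h : OccursAt (xiPow k ℓ) u i) (hP : P = i + (xiPow k ℓ).length) :
    (u P = (false, ℓ + 1) ∧ (proj (u (P + 1)) = true ∨ proj (u (P + 2)) = true)) ∨
    (u P = (true, 0) ∧ proj (u (P + 1)) = false ∧ proj (u (P + 2)) = false) ∨
    u P = (false, 0) := by
  obtain ⟨n, hi, hn⟩ := hu.exists_of_occursAt_xiPow_small hk (by omega) h
  have key : OccursAt ((xiW k)^[ℓ] [u (n + 1)] ++ (xiW k)^[ℓ] [u (n + 2)]) u P := by
    have h3 : OccursAt [u n, u (n + 1), u (n + 2)] u n := by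
      simp [occursAt_cons, occursAt_nil]
    have h4 := hu.occursAt_iterate ℓ h3
    rw [show [u n, u (n + 1), u (n + 2)] = [u n] ++ ([u (n + 1)] ++ [u (n + 2)]) from rfl,
      xiW_iterate_append, xiW_iterate_append, occursAt_append, ← hi, hn] at h4
    rw [hP]
    exact h4.2
  rcases hu.next_cases hk hn with ⟨h1, -⟩ | h1 | h1
  · left
    rw [h1, xiW_iterate_mid _ (by omega) (by omega), List.singleton_append, occursAt_cons] at key
    refine ⟨by rw [key.1]; simp [Nat.add_comm], ?_⟩
    rcases hu.next_cases hk h1 with ⟨h2, -⟩ | h2 | h2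
    · left
      rw [h2] at key
      by_cases hl : ℓ = k - 2
      · rw [xiW_iterate_wrap hk false (by omega) (by omega) (by omega), occursAt_singleton] at key
        simp [key.2, proj]
      · rw [xiW_iterate_mid false (by omega) (by omega), occursAt_singleton] at key
        simp [key.2, proj]
    · right
      rw [h2] at key
      by_cases hl : ℓ = 0
      · subst hl
        obtain ⟨m, rfl⟩ := hu.exists_imagePos_of_ne_one hk (i := n) (by simp [hn])
        have g := hu.preimage_zero_one hk hn (by rw [h1])
        obtain ⟨-, -, e⟩ := hu.image_zero g
        have hPn : P = imagePos k u m + 1 := by rw [hP, hi]; simp [xiPow]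
        rcases hu.next_cases hk g with ⟨g1, -⟩ | g1 | g1
        · have := (hu.image_mid g1 (by omega) (by omega)).1
          rw [e, h2] at this
          simp at this
        · have := (hu.image_zero g1).2.1
          rw [e] at this
          rw [hPn, show imagePos k u m + 1 + 2 = imagePos k u m + 2 + 1 from rfl, this]
          rfl
        · have := (hu.image_zero g1).1
          rw [e, h2] at this
          simp at this
      · obtain ⟨r, hr⟩ := xiW_iterate_zero_head_two k (Nat.pos_of_ne_zero hl) false
        rw [hr, occursAt_cons, occursAt_cons] at key
        rw [show P + 2 = P + 1 + 1 from rfl, key.2.2.1]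
        rfl
    · left
      obtain ⟨r, hr⟩ := xiW_iterate_zero_head k ℓ true
      rw [h2, Bool.not_false, hr, occursAt_cons] at key
      simp [key.2.1, proj]
  · right; right
    obtain ⟨r, hr⟩ := xiW_iterate_zero_head k ℓ false
    rw [h1, hr, List.cons_append, occursAt_cons] at key
    exact key.1
  · right; left
    have h2 := hu.next_of_zero_twin hk hn h1
    have h3 := hu.next_of_zero_twin_one hk hn h1
    rw [h1, h2] at key
    simp only [Bool.not_false] at key h2 h3
    rcases Nat.lt_or_ge ℓ 2 with hl | hl
    · interval_cases ℓ
      · have hPn : P = n + 1 := by rw [hP, hi]; simp [xiPow]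
        rw [hPn, h1, show n + 1 + 1 = n + 2 from rfl, h2]
        refine ⟨rfl, rfl, ?_⟩
        rcases hu.next_cases hk h2 with ⟨h4, -⟩ | h4 | h4
        · simp [h4, proj]
        · exact absurd h4 h3
        · simp [h4, proj]
      · simp only [Function.iterate_one, xiW_singleton] at key
        rw [xiL_zero, xiL_mid _ (by omega) (by omega)] at key
        simp only [List.cons_append, List.nil_append, occursAt_cons] at key
        obtain ⟨k0, k1, k2, -⟩ := key
        exact ⟨k0, by rw [k1]; rfl, by rw [k2]; rfl⟩
    · obtain ⟨r, hr⟩ := xiW_iterate_zero_head_three hk hl true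
      rw [hr] at key
      simp only [List.cons_append, occursAt_cons] at key
      obtain ⟨k0, k1, k2, -⟩ := key
      exact ⟨k0, by rw [k1]; rfl, by rw [k2]; rfl⟩

/-- The letters that can follow an occurrence of `ξ^(k+m)(0)` with `m ≤ k − 2`. -/
theorem after_xiPow_large (hk : 4 ≤ k) (hu : IsFixedPoint k u) {m i P : ℕ} (hm : m ≤ k - 2)
    (h : OccursAt (xiPow k (k + m)) u i) (hP : P = i + (xiPow k (k + m)).length) :
    u P = (true, 0) ∨
    (u P = (false, 0) ∧ proj (u (P + 1)) = true) ∨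
    (u P = (true, m + 1) ∧ proj (u (P + 1)) = false) := by
  obtain ⟨n, hi, hn⟩ := hu.exists_of_occursAt_xiPow_large hk hm h
  set Q := i + (xiPow k (k - 1 + m)).length with hQ
  have key : OccursAt ((xiW k)^[m + (k - 1)] [u (n + 1)] ++
      (xiW k)^[m + (k - 1)] [u (n + 2)]) u Q := by
    have h3 : OccursAt [u n, u (n + 1), u (n + 2)] u n := by
      simp [occursAt_cons, occursAt_nil]
    have h4 := hu.occursAt_iterate (m + (k - 1)) h3
    rw [show [u n, u (n + 1), u (n + 2)] = [u n] ++ ([u (n + 1)] ++ [u (n + 2)]) from rfl,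
      xiW_iterate_append, xiW_iterate_append, occursAt_append, ← hi, hn] at h4
    rw [hQ, Nat.add_comm (k - 1) m]
    exact h4.2
  rw [xiPow_add hk, List.length_append, ← Nat.add_assoc, ← hQ] at hP
  rw [xiPow_add hk, occursAt_append, ← hQ] at h
  rcases hu.next_cases hk hn with ⟨h1, -⟩ | h1 | h1
  · rw [h1, Function.iterate_add_apply _ m (k - 1) [((false : Bool), 0 + 1)],
      xiW_iterate_wrap hk false (by omega) (by omega) (by omega), occursAt_append,
      Bool.not_false, ← hP] at key
    rcases hu.next_cases hk h1 with ⟨h2, -⟩ | h2 | h2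
    · left
      have e : (xiW k)^[m + (k - 1)] [((false : Bool), 0 + 1 + 1)] =
          (xiW k)^[m + 1] [((true : Bool), 0)] := by
        rw [show m + (k - 1) = m + 1 + (k - 2) by omega, Function.iterate_add_apply,
          xiW_iterate_wrap hk false (by omega) (by omega) (by omega), Bool.not_false]
      obtain ⟨r, hr⟩ := xiW_iterate_zero_head k (m + 1) true
      rw [h2, e, hr, occursAt_cons] at key
      exact key.2.1
    · right; left
      obtain ⟨r, hr⟩ := xiW_iterate_zero_head_two k (show 1 ≤ m + (k - 1) by omega) false
      rw [h2, hr, occursAt_cons, occursAt_cons] at key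
      exact ⟨key.2.1, by rw [key.2.2.1]; rfl⟩
    · left
      obtain ⟨r, hr⟩ := xiW_iterate_zero_head k (m + (k - 1)) true
      rw [h2, Bool.not_false, hr, occursAt_cons] at key
      exact key.2.1
  · exfalso
    obtain ⟨r, hr⟩ := xiW_iterate_zero_head k (m + (k - 1)) false
    obtain ⟨r', hr'⟩ := xiW_iterate_zero_head k m true
    rw [h1, hr, List.cons_append, occursAt_cons] at key
    rw [hr', occursAt_cons] at h
    have := key.1.symm.trans h.2.1
    simp at this
  · right; right
    obtain ⟨r, hr⟩ := xiW_iterate_zero_head_three hk (show 2 ≤ k - 1 by omega) true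
    have e : (xiW k)^[m + (k - 1)] [((true : Bool), 0)] = (xiW k)^[m] [(true, 0)] ++
        ((xiW k)^[m] [(true, 1)] ++ ((xiW k)^[m] [(true, 2)] ++ (xiW k)^[m] r)) := by
      rw [Function.iterate_add_apply, hr, ← xiW_iterate_append, ← xiW_iterate_append,
        ← xiW_iterate_append]
      rfl
    rw [h1, Bool.not_false, e, xiW_iterate_mid true le_rfl (by omega), List.append_assoc,
      occursAt_append, ← hP] at key
    simp only [List.cons_append, List.nil_append, occursAt_cons] at key
    obtain ⟨-, k0, k1⟩ := key
    refine ⟨by rw [k0, Nat.add_comm], ?_⟩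
    by_cases hl : m = k - 2
    · rw [xiW_iterate_wrap hk true (by omega) (by omega) (by omega)] at k1
      simp only [List.cons_append, List.nil_append, occursAt_cons] at k1
      rw [k1.1]
      rfl
    · rw [xiW_iterate_mid true (by omega) (by omega)] at k1
      simp only [List.cons_append, List.nil_append, occursAt_cons] at k1
      rw [k1.1]
      simp [proj]

end IsFixedPoint

/-- for `k ≥ 4` and `w = ξ^ℓ(0)` with `0 ≤ ℓ ≤ 2k−2`, `ℓ ≠ k−1`, if
`x ≠ y` are right extensions of `w` with `π(x) = π(y)` and `wxs, wyt` are factors of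
`u_k` with `|s| = |t|` and `π(wxs) = π(wyt)`, then `|s| = |t| ≤ 1` when `ℓ ≤ k−2`
and `|s| = |t| = 0` when `k ≤ ℓ ≤ 2k−2`. -/
theorem stmt_14 (k : ℕ) (hk : 4 ≤ k) (u : ℕ → Letter) (hu : IsFixedPoint k u)
    (ℓ : ℕ) (hℓ : ℓ ≤ 2 * k - 2) (hℓ' : ℓ ≠ k - 1)
    (x y : Letter) (hxy : x ≠ y)
    (hx : x ∈ Rext (xiPow k ℓ) u) (hy : y ∈ Rext (xiPow k ℓ) u)
    (hproj : proj x = proj y)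
    (s t : List Letter) (hlen : s.length = t.length)
    (hs : FactorOf (xiPow k ℓ ++ x :: s) u) (ht : FactorOf (xiPow k ℓ ++ y :: t) u)
    (hmap : (xiPow k ℓ ++ x :: s).map proj = (xiPow k ℓ ++ y :: t).map proj) :
    (ℓ ≤ k - 2 → s.length ≤ 1) ∧ (k ≤ ℓ → s.length = 0) := by
  obtain ⟨i, hi⟩ := hs
  obtain ⟨j, hj⟩ := ht
  rw [occursAt_append] at hi hj
  obtain ⟨hi0, hi1⟩ := hi
  obtain ⟨hj0, hj1⟩ := hj
  rw [List.map_append, List.map_append, List.append_cancel_left_eq] at hmap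
  set P := i + (xiPow k ℓ).length with hP
  set Q := j + (xiPow k ℓ).length with hQ
  rw [occursAt_cons] at hi1 hj1
  obtain ⟨rfl, hs⟩ := hi1
  obtain ⟨rfl, ht⟩ := hj1
  constructor
  · intro hℓk
    by_contra! hlt
    obtain ⟨a, b, s, rfl⟩ : ∃ a b s', s = a :: b :: s' := by
      match s, hlt with
      | a :: b :: s, _ => exact ⟨a, b, s, rfl⟩
    obtain ⟨c, d, t, rfl⟩ : ∃ c d t', t = c :: d :: t' := by
      match t, hlen with
      | c :: d :: t, _ => exact ⟨c, d, t, rfl⟩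
    simp only [occursAt_cons] at hs ht
    obtain ⟨rfl, rfl, -⟩ := hs
    obtain ⟨rfl, rfl, -⟩ := ht
    simp only [List.map_cons, List.cons.injEq] at hmap
    obtain ⟨-, m1, m2, -⟩ := hmap
    have A := hu.after_xiPow_small hk hℓk hi0 hP
    have B := hu.after_xiPow_small hk hℓk hj0 hQ
    simp only [Nat.add_assoc, Nat.reduceAdd] at m1 m2
    rcases A with ⟨a0, a1⟩ | ⟨a0, a1, a2⟩ | a0 <;> rcases B with ⟨b0, b1⟩ | ⟨b0, b1, b2⟩ | b0 <;>
      first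
      | exact hxy (a0.trans b0.symm)
      | (rw [a0, b0] at hproj; simp [proj] at hproj; done)
      | simp_all
  · intro hkℓ
    by_contra hne
    obtain ⟨m, rfl⟩ := Nat.exists_eq_add_of_le hkℓ
    obtain ⟨a, s, rfl⟩ : ∃ a s', s = a :: s' := by
      match s, hne with
      | a :: s, _ => exact ⟨a, s, rfl⟩
    obtain ⟨c, t, rfl⟩ : ∃ c t', t = c :: t' := by
      match t, hlen with
      | c :: t, _ => exact ⟨c, t, rfl⟩
    rw [occursAt_cons] at hs ht
    obtain ⟨rfl, -⟩ := hs
    obtain ⟨rfl, -⟩ := ht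
    simp only [List.map_cons, List.cons.injEq] at hmap
    obtain ⟨-, m1, -⟩ := hmap
    have A := hu.after_xiPow_large hk (show m ≤ k - 2 by omega) hi0 hP
    have B := hu.after_xiPow_large hk (show m ≤ k - 2 by omega) hj0 hQ
    rcases A with a0 | ⟨a0, a1⟩ | ⟨a0, a1⟩ <;> rcases B with b0 | ⟨b0, b1⟩ | ⟨b0, b1⟩ <;>
      first
      | exact hxy (a0.trans b0.symm)
      | (rw [a0, b0] at hproj; simp [proj] at hproj; done)
      | simp_all
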